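/- Let n ≥ 5. Then n is even if and only if for every σ ∈ S_n the multiplicity of sign(σ) (viewed as ±1 in ℂ) as a root of P_σ(X) is strictly greater than the multiplicity of sign(σ) as a root of m_σ(X). Equivalently, the Specht module S^{(2²,1^{n−4})} = S^{(n−2,2)} ⊗ sgn is unisingular if and only if n is even, since 1 is an eigenvalue of σ on S^{(n−2,2)} ⊗ sgn exactly when sign(σ) is a root of the characteristic polynomial P_σ/m_σ of σ on S^{(n−2,2)}. -/

import Mathlib

open Polynomial

noncomputable section

/-- `m_σ(X)`: the characteristic polynomial of the `n × n` permutation matrix of `σ` over `ℂ`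
(the action on the permutation module `M^{(n-1,1)} = ℂ^n`). -/
def mPoly {n : ℕ} (σ : Equiv.Perm (Fin n)) : ℂ[X] :=
  (σ.permMatrix ℂ).charpoly

/-- The permutation induced by `σ` on the set of 2-element subsets of `{1, …, n}`. -/
def pairsPerm {n : ℕ} (σ : Equiv.Perm (Fin n)) :
    Equiv.Perm {s : Finset (Fin n) // s.card = 2} :=
  Equiv.Perm.subtypePerm (Equiv.finsetCongr σ) fun s => by
    simp [Equiv.finsetCongr_apply, Finset.card_map]

/-- `P_σ(X)`: the characteristic polynomial of the permutation matrix over `ℂ` of the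
permutation induced by `σ` on 2-element subsets (the action on `M^{(n-2,2)}`). -/
def PPoly {n : ℕ} (σ : Equiv.Perm (Fin n)) : ℂ[X] :=
  ((pairsPerm σ).permMatrix ℂ).charpoly

end

open Equiv.Perm Module Module.End

section Eigenspaces

variable {ι : Type*}

/-- The eigenspace of the permutation operator `v ↦ v ∘ σ` on functions, for the eigenvalue `μ`. -/
noncomputable abbrev permEigenspace (σ : Equiv.Perm ι) (μ : ℂ) : Submodule ℂ (ι → ℂ) :=
  eigenspace (LinearMap.funLeft ℂ ℂ σ) μ

theorem mem_permEigenspace {σ : Equiv.Perm ι} {μ : ℂ} {v : ι → ℂ} :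
    v ∈ permEigenspace σ μ ↔ ∀ i, v (σ i) = μ * v i := by
  simp [permEigenspace, funext_iff, LinearMap.funLeft_apply]

theorem funLeft_perm_pow (σ : Equiv.Perm ι) (k : ℕ) :
    LinearMap.funLeft ℂ ℂ σ ^ k = LinearMap.funLeft ℂ ℂ ⇑(σ ^ k) := by
  induction k with
  | zero => ext; simp [LinearMap.funLeft_apply]
  | succ k ih => rw [pow_succ', ih, pow_succ]; rfl

variable [Fintype ι]

theorem isSemisimple_funLeft_perm (σ : Equiv.Perm ι) :
    IsSemisimple (LinearMap.funLeft ℂ ℂ σ) := by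
  have hN : ((orderOf σ : ℕ) : ℂ) ≠ 0 := by exact_mod_cast (orderOf_pos σ).ne'
  refine isSemisimple_of_squarefree_aeval_eq_zero
    (Polynomial.X_pow_sub_one_separable_iff.2 hN).squarefree ?_
  ext v i
  simp [funLeft_perm_pow, pow_orderOf_eq_one]

variable [DecidableEq ι]

theorem rootMultiplicity_charpoly_permMatrix (σ : Equiv.Perm ι) (μ : ℂ) :
    (σ.permMatrix ℂ).charpoly.rootMultiplicity μ = finrank ℂ (permEigenspace σ μ) := by
  have h : (σ.permMatrix ℂ).toLin' = LinearMap.funLeft ℂ ℂ σ :=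
    LinearMap.ext fun v => by
      rw [Matrix.toLin'_apply, Matrix.permMatrix_mulVec]; rfl
  rw [← Matrix.charpoly_toLin', h, ← LinearMap.finrank_maxGenEigenspace_eq,
    (isSemisimple_funLeft_perm σ).isFinitelySemisimple.maxGenEigenspace_eq_eigenspace]

end Eigenspaces

section PairSum

variable {n : ℕ}

/-- The equivariant map `M^{(n-1,1)} → M^{(n-2,2)}` sending `f` to `{i, j} ↦ f i + f j`. -/
def pairSum (n : ℕ) :
    (Fin n → ℂ) →ₗ[ℂ] ({s : Finset (Fin n) // s.card = 2} → ℂ) where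
  toFun f s := ∑ i ∈ s.1, f i
  map_add' f g := by ext s; simp [Finset.sum_add_distrib]
  map_smul' c f := by ext s; simp [Finset.mul_sum]

theorem pairSum_pair (f : Fin n → ℂ) {a b : Fin n} (h : a ≠ b) :
    pairSum n f ⟨{a, b}, Finset.card_pair h⟩ = f a + f b :=
  Finset.sum_pair h

theorem pairSum_pairsPerm (σ : Equiv.Perm (Fin n)) (f : Fin n → ℂ)
    (s : {s : Finset (Fin n) // s.card = 2}) :
    pairSum n f (pairsPerm σ s) = pairSum n (f ∘ σ) s :=
  Finset.sum_map _ _ _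

theorem pairsPerm_pair (σ : Equiv.Perm (Fin n)) {a b : Fin n} (h : a ≠ b) :
    pairsPerm σ ⟨{a, b}, Finset.card_pair h⟩ =
      ⟨{σ a, σ b}, Finset.card_pair (σ.injective.ne h)⟩ := by
  apply Subtype.ext
  simp [pairsPerm, Equiv.finsetCongr_apply, Finset.map_insert]

theorem pairSum_injective (hn : 3 ≤ n) : Function.Injective (pairSum n) := by
  refine (injective_iff_map_eq_zero _).2 fun f hf => funext fun a => ?_
  have hpair : ∀ {x y : Fin n}, x ≠ y → f x + f y = 0 := fun {x y} h => by
    rw [← pairSum_pair f h, hf]; rfl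
  obtain ⟨b, hb, c, hc, hbc⟩ := Finset.one_lt_card.1
    (show 1 < ({a}ᶜ : Finset (Fin n)).card by
      rw [Finset.card_compl, Finset.card_singleton, Fintype.card_fin]; omega)
  simp only [Finset.mem_compl, Finset.mem_singleton] at hb hc
  have h₁ := hpair (Ne.symm hb)
  have h₂ := hpair (Ne.symm hc)
  have h₃ := hpair hbc
  simp only [Pi.zero_apply]
  linear_combination (h₁ + h₂ - h₃) / 2

theorem map_pairSum_le (σ : Equiv.Perm (Fin n)) (μ : ℂ) :
    (permEigenspace σ μ).map (pairSum n) ≤ permEigenspace (pairsPerm σ) μ := by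
  rintro _ ⟨f, hf, rfl⟩
  refine mem_permEigenspace.2 fun s => ?_
  have h : f ∘ σ = μ • f := funext (mem_permEigenspace.1 hf)
  rw [pairSum_pairsPerm, h, map_smul]
  rfl

/-- The function on 2-subsets obtained by symmetrizing a function of two variables. -/
def symmPair (g : Fin n → Fin n → ℂ) (s : {s : Finset (Fin n) // s.card = 2}) : ℂ :=
  ∑ p ∈ s.1.offDiag, g p.1 p.2

theorem symmPair_pair (g : Fin n → Fin n → ℂ) {a b : Fin n} (h : a ≠ b) :
    symmPair g ⟨{a, b}, Finset.card_pair h⟩ = g a b + g b a := by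
  rw [symmPair, Finset.offDiag_insert (by simpa using h)]
  simp [h, h.symm]

theorem exists_eq_pair (s : {s : Finset (Fin n) // s.card = 2}) :
    ∃ (a b : Fin n) (h : a ≠ b), s = ⟨{a, b}, Finset.card_pair h⟩ := by
  obtain ⟨a, b, h, hs⟩ := Finset.card_eq_two.1 s.2
  exact ⟨a, b, h, Subtype.ext hs⟩

/-- Multiplicities increase strictly as soon as the `μ`-eigenspace on 2-subsets contains a function
that is not of the form `{i, j} ↦ f i + f j`. -/
theorem rootMultiplicity_lt_of_symmPair (hn : 3 ≤ n) {σ : Equiv.Perm (Fin n)} {μ : ℂ}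
    {g : Fin n → Fin n → ℂ} (hg : ∀ x y, g (σ x) (σ y) = μ * g x y) {a b c d : Fin n}
    (hab : a ≠ b) (hcd : c ≠ d) (hac : a ≠ c) (hbd : b ≠ d)
    (hne : (g a b + g b a) + (g c d + g d c) ≠ (g a c + g c a) + (g b d + g d b)) :
    (mPoly σ).rootMultiplicity μ < (PPoly σ).rootMultiplicity μ := by
  rw [mPoly, PPoly, rootMultiplicity_charpoly_permMatrix, rootMultiplicity_charpoly_permMatrix,
    (Submodule.equivMapOfInjective (pairSum n) (pairSum_injective hn) _).finrank_eq]
  refine Submodule.finrank_lt_finrank_of_lt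
    ((SetLike.lt_iff_le_and_exists).2 ⟨map_pairSum_le σ μ, symmPair g, ?_, ?_⟩)
  · refine mem_permEigenspace.2 fun s => ?_
    obtain ⟨x, y, h, rfl⟩ := exists_eq_pair s
    rw [pairsPerm_pair σ h, symmPair_pair g h, symmPair_pair g (σ.injective.ne h), hg, hg, mul_add]
  · rintro ⟨f, -, hf⟩
    refine hne ?_
    rw [← symmPair_pair g hab, ← symmPair_pair g hcd, ← symmPair_pair g hac,
      ← symmPair_pair g hbd, ← hf, pairSum_pair f hab, pairSum_pair f hcd, pairSum_pair f hac,
      pairSum_pair f hbd]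
    ring

end PairSum

section EigenvalueOne

variable {n : ℕ}

theorem rootMultiplicity_one_lt (hn : 5 ≤ n) (σ : Equiv.Perm (Fin n)) :
    (mPoly σ).rootMultiplicity 1 < (PPoly σ).rootMultiplicity 1 := by
  by_cases hlong : ∃ x, σ x ≠ x ∧ σ (σ x) ≠ x ∧ σ (σ (σ x)) ≠ x
  · obtain ⟨x, h₁, h₂, h₃⟩ := hlong
    refine rootMultiplicity_lt_of_symmPair (by omega)
      (g := fun u v => if v = σ u then 1 else 0)
      (a := x) (b := σ x) (c := σ (σ x)) (d := σ (σ (σ x))) (by simp)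
      (Ne.symm h₁) (by simpa using Ne.symm h₁) (Ne.symm h₂) (by simpa using Ne.symm h₂) ?_
    simp [h₁, h₂.symm, h₃.symm]
  -- It remains to find an invariant set `A` with at least two points inside and outside.
  · obtain ⟨A, hA, hA₂, hA₃⟩ : ∃ A : Finset (Fin n),
        (∀ x, σ x ∈ A ↔ x ∈ A) ∧ 1 < A.card ∧ A.card ≤ 3 := by
      by_cases hσ : ∃ x, σ x ≠ x
      · obtain ⟨x, hx⟩ := hσ
        have hx' : σ (σ x) = x ∨ σ (σ (σ x)) = x := by
          by_contra! h
          exact hlong ⟨x, hx, h⟩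
        refine ⟨{x, σ x, σ (σ x)}, fun y => ?_, ?_, Finset.card_le_three⟩
        · rcases hx' with h | h
          · simp only [Finset.mem_insert, Finset.mem_singleton, h, σ.injective.eq_iff]
            rw [← σ.injective.eq_iff (a := y) (b := σ x), h]
            tauto
          · simp only [Finset.mem_insert, Finset.mem_singleton, σ.injective.eq_iff]
            rw [← σ.injective.eq_iff (a := y) (b := σ (σ x)), h]
            tauto
        · exact Finset.one_lt_card.2 ⟨x, by simp, σ x, by simp, Ne.symm hx⟩
      · push Not at hσ
        refine ⟨{⟨0, by omega⟩, ⟨1, by omega⟩}, fun x => by rw [hσ], ?_, ?_⟩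
        · rw [Finset.card_pair (by simp)]; norm_num
        · exact Finset.card_le_two.trans (by norm_num)
    obtain ⟨a, ha, b, hb, hab⟩ := Finset.one_lt_card.1 hA₂
    obtain ⟨c, hc, d, hd, hcd⟩ := Finset.one_lt_card.1
      (show 1 < Aᶜ.card by rw [Finset.card_compl, Fintype.card_fin]; omega)
    rw [Finset.mem_compl] at hc hd
    refine rootMultiplicity_lt_of_symmPair (by omega)
      (g := fun u v => if u ∈ A ∧ v ∈ A then 1 else 0)
      (a := a) (b := b) (c := c) (d := d) (by simp [hA])
      hab hcd (ne_of_mem_of_not_mem ha hc) (ne_of_mem_of_not_mem hb hd) ?_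
    simp [ha, hb, hc, hd]

end EigenvalueOne

section EigenvalueNegOne

variable {n : ℕ}

theorem exists_not_sameCycle_sq {α : Type*} [Fintype α] [DecidableEq α] {σ : Equiv.Perm α}
    (hσ : sign σ = -1) : ∃ x, ¬ SameCycle (σ ^ 2) x (σ x) := by
  by_contra! h
  have hodd : ∀ x, ∃ m : ℤ, Odd m ∧ (σ ^ m) x = x := fun x => by
    obtain ⟨k, hk⟩ := h x
    refine ⟨2 * k - 1, ⟨k - 1, by ring⟩, ?_⟩
    have hk' : (σ ^ (2 * k)) x = σ x := by rw [zpow_mul]; exact hk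
    rw [show 2 * k - 1 = -1 + 2 * k by ring, zpow_add, mul_apply, hk', zpow_neg_one]
    exact σ.symm_apply_apply x
  choose m hm hmx using hodd
  have hN : σ ^ (∏ x, m x) = 1 := by
    refine Equiv.ext fun x => ?_
    rw [← Finset.mul_prod_erase _ _ (Finset.mem_univ x), zpow_mul]
    exact zpow_apply_eq_self_of_apply_eq_self (hmx x) _
  have hNodd : Odd (∏ x, m x) :=
    Finset.prod_induction m Odd (fun _ _ => Odd.mul) odd_one fun x _ => hm x
  have hs := congrArg sign hN
  rw [map_zpow, hσ, hNodd.neg_one_zpow, map_one] at hs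
  exact absurd hs (by decide)

/-- The function alternating between `1` and `-1` along the `σ`-orbit of `x`
(if that orbit has even length), and vanishing outside of it. -/
def altSign (σ : Equiv.Perm (Fin n)) (x y : Fin n) : ℂ :=
  (if SameCycle (σ ^ 2) x y then 1 else 0) - if SameCycle (σ ^ 2) x (σ y) then 1 else 0

theorem altSign_apply (σ : Equiv.Perm (Fin n)) (x y : Fin n) :
    altSign σ x (σ y) = -altSign σ x y := by
  have h : SameCycle (σ ^ 2) x (σ (σ y)) ↔ SameCycle (σ ^ 2) x y :=
    sameCycle_apply_right (f := σ ^ 2)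
  simp [altSign, h]

theorem altSign_self {σ : Equiv.Perm (Fin n)} {x : Fin n} (hx : ¬ SameCycle (σ ^ 2) x (σ x)) :
    altSign σ x x = 1 := by
  simp [altSign, hx, SameCycle.rfl]

theorem altSign_of_not_sameCycle {σ : Equiv.Perm (Fin n)} {x y : Fin n}
    (hy : ¬ SameCycle σ x y) : altSign σ x y = 0 := by
  have h₁ : ¬ SameCycle (σ ^ 2) x y := fun h => hy h.of_pow
  have h₂ : ¬ SameCycle (σ ^ 2) x (σ y) := fun h => hy (sameCycle_apply_right.1 h.of_pow)
  simp [altSign, h₁, h₂]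

theorem rootMultiplicity_neg_one_lt_of_three_orbits (hn : 3 ≤ n) {σ : Equiv.Perm (Fin n)}
    {x y z : Fin n} (hx : ¬ SameCycle (σ ^ 2) x (σ x)) (hxy : ¬ SameCycle σ x y)
    (hxz : ¬ SameCycle σ x z) (hyz : ¬ SameCycle σ y z) :
    (mPoly σ).rootMultiplicity (-1) < (PPoly σ).rootMultiplicity (-1) := by
  have hxσ : SameCycle σ x (σ x) := sameCycle_apply_right.2 SameCycle.rfl
  have hyσ : ¬ SameCycle σ y (σ x) := fun h => hxy (hxσ.trans h.symm)
  have hyx : ¬ SameCycle σ y x := fun h => hxy h.symm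
  refine rootMultiplicity_lt_of_symmPair hn
    (g := fun u v => altSign σ x u * if SameCycle σ y v then 1 else 0)
    (a := x) (b := y) (c := z) (d := σ x)
    (fun u v => by simp [altSign_apply, sameCycle_apply_right])
    ?_ ?_ ?_ ?_ ?_
  · rintro rfl; exact hxy SameCycle.rfl
  · rintro rfl; exact hxz hxσ
  · rintro rfl; exact hxz SameCycle.rfl
  · rintro rfl; exact hxy hxσ
  · simp [altSign_self hx, altSign_apply, altSign_of_not_sameCycle hxy,
      altSign_of_not_sameCycle hxz, hyz, hyσ, hyx, SameCycle.rfl]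
    norm_num

theorem pow_apply_ne_of_single_orbit {σ : Equiv.Perm (Fin n)} {x : Fin n}
    (hx : ∀ y, SameCycle σ x y) {k : ℕ} (hk : 0 < k) (hkn : k < n) : (σ ^ k) x ≠ x := by
  intro h
  have hsurj : Function.Surjective fun i : Fin k => (σ ^ (i : ℕ)) x := fun y => by
    obtain ⟨i, rfl⟩ := (hx y).exists_nat_pow_eq
    refine ⟨⟨i % k, Nat.mod_lt _ hk⟩, ?_⟩
    conv_rhs => rw [← Nat.mod_add_div i k, pow_add, mul_apply, pow_mul,
      pow_apply_eq_self_of_apply_eq_self h]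
  have := Fintype.card_le_of_surjective _ hsurj
  simp only [Fintype.card_fin] at this
  omega

theorem rootMultiplicity_neg_one_lt_of_single_orbit (hn : 6 ≤ n) {σ : Equiv.Perm (Fin n)}
    {x : Fin n} (hx : ¬ SameCycle (σ ^ 2) x (σ x)) (htrans : ∀ y, SameCycle σ x y) :
    (mPoly σ).rootMultiplicity (-1) < (PPoly σ).rootMultiplicity (-1) := by
  have hpow : ∀ k, 0 < k → k < 6 → (σ ^ k) x ≠ x := fun k hk hk6 =>
    pow_apply_ne_of_single_orbit htrans hk (by omega)
  have h₁ : σ x ≠ x := hpow 1 (by norm_num) (by norm_num)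
  have h₂ : σ (σ x) ≠ x := hpow 2 (by norm_num) (by norm_num)
  have h₃ : σ (σ (σ x)) ≠ x := hpow 3 (by norm_num) (by norm_num)
  have h₄ : σ (σ (σ (σ x))) ≠ x := hpow 4 (by norm_num) (by norm_num)
  have h₅ : σ (σ (σ (σ (σ x)))) ≠ x := hpow 5 (by norm_num) (by norm_num)
  refine rootMultiplicity_lt_of_symmPair (by omega)
    (g := fun u v => altSign σ x u * if v = σ u then 1 else 0)
    (a := x) (b := σ x) (c := σ (σ (σ x))) (d := σ (σ (σ (σ (σ x)))))
    (fun u v => by simp [altSign_apply]) h₁.symm (by simpa using h₂.symm) h₃.symm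
    (by simpa using h₄.symm) ?_
  simp [altSign_self hx, altSign_apply, h₁, h₂, h₃, h₂.symm, h₃.symm, h₄.symm, h₅.symm]

theorem sign_eq_neg_one_pow_of_single_orbit_compl {α : Type*} [Fintype α] [DecidableEq α]
    {σ : Equiv.Perm α} (x y : α) (hxy : ¬ SameCycle σ x y)
    (h : ∀ z, SameCycle σ x z ∨ SameCycle σ y z) :
    sign σ = (-1) ^ Fintype.card α := by
  have hsign : ∀ w, sign (cycleOf σ w) =
      -(-1) ^ (Finset.univ.filter fun z => SameCycle σ w z).card := fun w => by
    by_cases hw : σ w = w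
    · have : (Finset.univ.filter fun z => SameCycle σ w z) = {w} := by
        ext z
        simp only [Finset.mem_filter, Finset.mem_univ, true_and, Finset.mem_singleton]
        exact ⟨fun hz => (hz.eq_of_left hw).symm, fun hz => hz ▸ SameCycle.rfl⟩
      rw [this, (cycleOf_eq_one_iff σ).2 hw]
      simp
    · rw [(isCycle_cycleOf σ hw).sign]
      congr 3
      ext z
      simp [mem_support_cycleOf_iff' hw]
  have hσ : σ = cycleOf σ x * cycleOf σ y := by
    ext z
    rw [mul_apply]
    rcases h z with hz | hz
    · have hyz : ¬ SameCycle σ y z := fun h' => hxy (hz.trans h'.symm)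
      rw [cycleOf_apply_of_not_sameCycle hyz, hz.cycleOf_apply]
    · have hxz : ¬ SameCycle σ x (σ z) := fun h' =>
        hxy ((sameCycle_apply_right.1 h').trans hz.symm)
      rw [hz.cycleOf_apply, cycleOf_apply_of_not_sameCycle hxz]
  have hcompl : (Finset.univ.filter fun z => SameCycle σ y z) =
      (Finset.univ.filter fun z => SameCycle σ x z)ᶜ := by
    ext z
    simp only [Finset.mem_filter, Finset.mem_univ, true_and, Finset.mem_compl]
    exact ⟨fun h₁ h₂ => hxy (h₂.trans h₁.symm), (h z).resolve_left⟩
  conv_lhs => rw [hσ]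
  rw [map_mul, hsign, hsign, neg_mul_neg, ← pow_add, hcompl, Finset.card_add_card_compl]

theorem rootMultiplicity_neg_one_lt (hn : 5 ≤ n) (heven : Even n) {σ : Equiv.Perm (Fin n)}
    (hσ : sign σ = -1) :
    (mPoly σ).rootMultiplicity (-1) < (PPoly σ).rootMultiplicity (-1) := by
  obtain ⟨x, hx⟩ := exists_not_sameCycle_sq hσ
  by_cases htrans : ∀ y, SameCycle σ x y
  · have hn6 : 6 ≤ n := by
      obtain ⟨k, rfl⟩ := heven
      omega
    exact rootMultiplicity_neg_one_lt_of_single_orbit hn6 hx htrans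
  push Not at htrans
  obtain ⟨y, hxy⟩ := htrans
  by_cases htwo : ∀ z, SameCycle σ x z ∨ SameCycle σ y z
  · have h := sign_eq_neg_one_pow_of_single_orbit_compl x y hxy htwo
    rw [hσ, Fintype.card_fin, heven.neg_one_pow] at h
    exact absurd h (by decide)
  · push Not at htwo
    obtain ⟨z, hxz, hyz⟩ := htwo
    exact rootMultiplicity_neg_one_lt_of_three_orbits (by omega) hx hxy hxz hyz

end EigenvalueNegOne

section OddDegree

variable {n : ℕ}

/-- The function of two variables underlying a function on 2-subsets, extended by zero. -/
def pairValue (F : {s : Finset (Fin n) // s.card = 2} → ℂ) (x y : Fin n) : ℂ :=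
  if h : x ≠ y then F ⟨{x, y}, Finset.card_pair h⟩ else 0

theorem pairValue_of_ne (F : {s : Finset (Fin n) // s.card = 2} → ℂ) {x y : Fin n} (h : x ≠ y) :
    pairValue F x y = F ⟨{x, y}, Finset.card_pair h⟩ :=
  dif_pos h

theorem pairValue_comm (F : {s : Finset (Fin n) // s.card = 2} → ℂ) (x y : Fin n) :
    pairValue F x y = pairValue F y x := by
  unfold pairValue
  simp only [Finset.pair_comm x y, ne_comm (a := x)]

theorem pairValue_apply {σ : Equiv.Perm (Fin n)} {μ : ℂ}
    {F : {s : Finset (Fin n) // s.card = 2} → ℂ} (hF : F ∈ permEigenspace (pairsPerm σ) μ)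
    (x y : Fin n) : pairValue F (σ x) (σ y) = μ * pairValue F x y := by
  by_cases h : x = y
  · simp [pairValue, h]
  · rw [pairValue_of_ne F h, pairValue_of_ne F (σ.injective.ne h),
      ← mem_permEigenspace.1 hF, pairsPerm_pair σ h]

theorem pairValue_pow_apply {σ : Equiv.Perm (Fin n)} {μ : ℂ}
    {F : {s : Finset (Fin n) // s.card = 2} → ℂ} (hF : F ∈ permEigenspace (pairsPerm σ) μ)
    (k : ℕ) (x y : Fin n) :
    pairValue F ((σ ^ k) x) ((σ ^ k) y) = μ ^ k * pairValue F x y := by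
  induction k with
  | zero => simp
  | succ k ih => rw [pow_succ', mul_apply, mul_apply, pairValue_apply hF, ih]; ring

/-- If `σ` is a transposition times a disjoint cycle of odd length on the remaining points, then
the eigenvalue `-1` has the same multiplicity in both permutation modules. -/
theorem rootMultiplicity_neg_one_le {σ : Equiv.Perm (Fin n)} {a b : Fin n} (hn : 3 ≤ n)
    (hab : a ≠ b) (ha : σ a = b) (hb : σ b = a) {N : ℕ} (hN : Odd N)
    (hfix : ∀ d, d ≠ a → d ≠ b → (σ ^ N) d = d)
    (htrans : ∀ d, d ≠ a → d ≠ b → ∀ d', d' ≠ a → d' ≠ b → ∃ k, (σ ^ (2 * k)) d = d') :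
    (PPoly σ).rootMultiplicity (-1) ≤ (mPoly σ).rootMultiplicity (-1) := by
  rw [mPoly, PPoly, rootMultiplicity_charpoly_permMatrix, rootMultiplicity_charpoly_permMatrix,
    (Submodule.equivMapOfInjective (pairSum n) (pairSum_injective hn) _).finrank_eq]
  refine Submodule.finrank_mono fun F hF => ?_
  obtain ⟨c, hc⟩ : ∃ c, c ∈ ({a, b}ᶜ : Finset (Fin n)) := Finset.card_pos.1 (by
    rw [Finset.card_compl, Finset.card_pair hab, Fintype.card_fin]; omega)
  simp only [Finset.mem_compl, Finset.mem_insert, Finset.mem_singleton, not_or] at hc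
  have hsq : ∀ k, (σ ^ (2 * k)) a = a := fun k => by
    rw [pow_mul]
    exact pow_apply_eq_self_of_apply_eq_self (by rw [sq, mul_apply, ha, hb]) k
  have hzero : ∀ d, d ≠ a → d ≠ b → ∀ d', d' ≠ a → d' ≠ b → pairValue F d d' = 0 := by
    intro d hda hdb d' hda' hdb'
    have h := pairValue_pow_apply hF N d d'
    rw [hfix d hda hdb, hfix d' hda' hdb', hN.neg_one_pow] at h
    linear_combination h / 2
  have hF_ab : pairValue F a b = 0 := by
    have h := pairValue_apply hF a b
    rw [ha, hb, pairValue_comm] at h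
    linear_combination h / 2
  have hF_a : ∀ d, d ≠ a → d ≠ b → pairValue F a d = pairValue F a c := by
    intro d hda hdb
    obtain ⟨k, rfl⟩ := htrans c hc.1 hc.2 d hda hdb
    have h := pairValue_pow_apply hF (2 * k) a c
    rwa [hsq, (even_two_mul k).neg_one_pow, one_mul] at h
  have hF_b : ∀ d, d ≠ a → d ≠ b → pairValue F b d = -pairValue F a c := by
    intro d hda hdb
    obtain ⟨d, rfl⟩ := σ.surjective d
    have h := pairValue_apply hF a d
    rw [ha, hF_a d (fun h' => hdb (h' ▸ ha)) (fun h' => hda (h' ▸ hb))] at h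
    rw [h, neg_one_mul]
  refine ⟨fun x => if x = a then pairValue F a c else if x = b then -pairValue F a c else 0,
    mem_permEigenspace.2 fun x => ?_, funext fun s => ?_⟩
  · have h₁ : σ x = a ↔ x = b := by rw [← hb, σ.injective.eq_iff]
    have h₂ : σ x = b ↔ x = a := by rw [← ha, σ.injective.eq_iff]
    simp only [h₁, h₂]
    by_cases hxa : x = a
    · simp [hxa, hab]
    · by_cases hxb : x = b <;> simp [hxa, hxb, hab.symm]
  · obtain ⟨x, y, h, rfl⟩ := exists_eq_pair s
    rw [pairSum_pair _ h, ← pairValue_of_ne F h]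
    by_cases hxa : x = a
    · subst hxa
      by_cases hyb : y = b
      · simp [hyb, hF_ab, hab.symm]
      · simp [h.symm, hyb, hF_a y h.symm hyb]
    by_cases hxb : x = b
    · subst hxb
      by_cases hya : y = a
      · simp [hya, pairValue_comm F x a, hF_ab, hab.symm]
      · simp [h.symm, hya, hab.symm, hF_b y hya h.symm]
    by_cases hya : y = a
    · simp [hya, hxa, hxb, pairValue_comm F x a, hF_a x hxa hxb]
    by_cases hyb : y = b
    · simp [hyb, hxa, hxb, hab.symm, pairValue_comm F x b, hF_b x hxa hxb]
    · simp [hxa, hxb, hya, hyb, hzero x hxa hxb y hya hyb]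

theorem finRotate_pow_self {m : ℕ} (hm : 2 ≤ m) : finRotate m ^ m = 1 := by
  refine orderOf_dvd_iff_pow_eq_one.1 (dvd_of_eq ?_)
  rw [(isCycle_finRotate_of_le hm).orderOf, support_finRotate_of_le hm, Finset.card_univ,
    Fintype.card_fin]

theorem exists_finRotate_sq_pow_apply_eq {m : ℕ} (hm : 2 ≤ m) (hodd : Odd m) (i j : Fin m) :
    ∃ k, (finRotate m ^ (2 * k)) i = j := by
  have hmove : ∀ i, finRotate m i ≠ i := fun i =>
    mem_support.1 (by rw [support_finRotate_of_le hm]; exact Finset.mem_univ i)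
  obtain ⟨k, hk⟩ := ((isCycle_finRotate_of_le hm).sameCycle (hmove i) (hmove j)).exists_nat_pow_eq
  rcases Nat.even_or_odd k with hk' | hk'
  · obtain ⟨l, rfl⟩ := hk'
    exact ⟨l, by rwa [two_mul]⟩
  · obtain ⟨l, hl⟩ := hk'.add_odd hodd
    exact ⟨l, by rw [two_mul, ← hl, pow_add, finRotate_pow_self hm, mul_one, hk]⟩

theorem exists_sign_neg_one_rootMultiplicity_le (hn : 5 ≤ n) (hodd : Odd n) :
    ∃ σ : Equiv.Perm (Fin n), sign σ = -1 ∧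
      (PPoly σ).rootMultiplicity (-1) ≤ (mPoly σ).rootMultiplicity (-1) := by
  obtain ⟨m, rfl⟩ := Nat.exists_eq_add_of_le (show 2 ≤ n by omega)
  have hm : Odd m := by
    rcases hodd with ⟨k, hk⟩
    exact ⟨k - 1, by omega⟩
  let e : Fin 2 ⊕ Fin m ≃ Fin (2 + m) := finSumFinEquiv
  let σ : Equiv.Perm (Fin (2 + m)) :=
    e.permCongr (Equiv.Perm.sumCongr (Equiv.swap 0 1) (finRotate m))
  have hσl : ∀ i, σ (e (.inl i)) = e (.inl (Equiv.swap 0 1 i)) := fun i => by simp [σ]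
  have hσr : ∀ k i, (σ ^ k) (e (.inr i)) = e (.inr ((finRotate m ^ k) i)) := fun k i => by
    induction k with
    | zero => rfl
    | succ k ih => rw [pow_succ', mul_apply, ih, pow_succ', mul_apply]; simp [σ]
  have hr : ∀ d, d ≠ e (.inl 0) → d ≠ e (.inl 1) → ∃ i, d = e (.inr i) := by
    intro d h₀ h₁
    obtain ⟨i | i, rfl⟩ := e.surjective d
    · fin_cases i
      · exact absurd rfl h₀
      · exact absurd rfl h₁
    · exact ⟨i, rfl⟩
  refine ⟨σ, ?_, rootMultiplicity_neg_one_le (a := e (.inl 0)) (b := e (.inl 1)) (N := m)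
    (by omega) (by simp) (by rw [hσl]; simp) (by rw [hσl]; simp) hm ?_ ?_⟩
  · have hm' : Even (m - 1) := hm.tsub_odd odd_one
    rw [sign_permCongr, sign_sumCongr, sign_swap (by simp), sign_finRotate, hm'.neg_one_pow,
      mul_one]
  · intro d h₀ h₁
    obtain ⟨i, rfl⟩ := hr d h₀ h₁
    rw [hσr, finRotate_pow_self (by omega), one_apply]
  · intro d h₀ h₁ d' h₀' h₁'
    obtain ⟨i, rfl⟩ := hr d h₀ h₁
    obtain ⟨j, rfl⟩ := hr d' h₀' h₁'
    obtain ⟨k, hk⟩ := exists_finRotate_sq_pow_apply_eq (by omega) hm i j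
    exact ⟨k, by rw [hσr, hk]⟩

end OddDegree

/-- For `n ≥ 5`, `n` is even iff for every `σ ∈ S_n` the multiplicity of `sign σ` (viewed in
`ℂ`) as a root of `P_σ(X)` strictly exceeds its multiplicity as a root of `m_σ(X)`;
i.e. the Specht module `S^{(2²,1^{n-4})} = S^{(n-2,2)} ⊗ sgn` is unisingular iff `n` is even. -/
theorem specht_22_unisingular_iff (n : ℕ) (hn : 5 ≤ n) :
    Even n ↔ ∀ σ : Equiv.Perm (Fin n),
      (mPoly σ).rootMultiplicity ((Equiv.Perm.sign σ : ℤ) : ℂ) <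
        (PPoly σ).rootMultiplicity ((Equiv.Perm.sign σ : ℤ) : ℂ) := by
  refine ⟨fun heven σ => ?_, fun h => ?_⟩
  · rcases Int.units_eq_one_or (sign σ) with hσ | hσ
    · simpa [hσ] using rootMultiplicity_one_lt hn σ
    · simpa [hσ] using rootMultiplicity_neg_one_lt hn heven hσ
  · by_contra hodd
    obtain ⟨σ, hσ, hle⟩ :=
      exists_sign_neg_one_rootMultiplicity_le hn (Nat.not_even_iff_odd.1 hodd)
    exact absurd (h σ) (by simpa [hσ] using hle)
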